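/- For every n ≥ 2, g_{n+1} = (2^n w_n + 2 y_n)(2 x_n + w_n) + 2^n x_n² + 2 x_n z_n + 2, where g_{n+1} = c_{n+1} + 2 e_{n+1} + f_{n+1}. -/

import Mathlib

namespace Paper

/-- `s i = 2^{ν₂(i+1)}`, the largest power of 2 dividing `i+1`. -/
def s (i : ℕ) : ℕ := 2 ^ padicValNat 2 (i + 1)

/-- Continuant numerators, shifted by 2: `p 0 = p_{-2} = 0`, `p 1 = p_{-1} = 1`,
and `p (n+2) = p_n = s_n p_{n-1} + p_{n-2}`. -/
def p : ℕ → ℤ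
  | 0 => 0
  | 1 => 1
  | n + 2 => (s n : ℤ) * p (n + 1) + p n

/-- Continuant denominators, shifted by 2: `q 0 = q_{-2} = 1`, `q 1 = q_{-1} = 0`,
and `q (n+2) = q_n = s_n q_{n-1} + q_{n-2}`. -/
def q : ℕ → ℤ
  | 0 => 1
  | 1 => 0
  | n + 2 => (s n : ℤ) * q (n + 1) + q n

/-- Hurwitz–Kolden–Frame matrix of a finite sequence. -/
def M (l : List ℤ) : Matrix (Fin 2) (Fin 2) ℤ :=
  (l.map fun a => !![a, 1; 1, 0]).prod

/-- `u n = (s_1, s_2, ..., s_{2^n - 3})`. -/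
def u (n : ℕ) : List ℤ := (List.range (2 ^ n - 3)).map fun i => (s (i + 1) : ℤ)

/-- `v n = (s_1, s_2, ..., s_{2^n - 2})`. -/
def v (n : ℕ) : List ℤ := (List.range (2 ^ n - 2)).map fun i => (s (i + 1) : ℤ)

def c (n : ℕ) : ℤ := M (u n) 0 0
def e (n : ℕ) : ℤ := M (u n) 0 1
def d (n : ℕ) : ℤ := M (u n) 1 0
def f (n : ℕ) : ℤ := M (u n) 1 1
def w (n : ℕ) : ℤ := M (v n) 0 0
def y (n : ℕ) : ℤ := M (v n) 0 1
def x (n : ℕ) : ℤ := M (v n) 1 0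
def z (n : ℕ) : ℤ := M (v n) 1 1
def g (n : ℕ) : ℤ := c n + 2 * e n + f n
def r (n : ℕ) : ℤ := 2 ^ n * (w n + x n) + w n + y n + z n

end Paper

namespace Paper

lemma M_append (l₁ l₂ : List ℤ) : M (l₁ ++ l₂) = M l₁ * M l₂ := by
  simp [M]

lemma M_singleton (a : ℤ) : M [a] = !![a, 1; 1, 0] := by
  simp [M]

lemma M_reverse (l : List ℤ) : M l.reverse = (M l).transpose := by
  induction l with
  | nil => simp [M]
  | cons a l ih =>
    have hcons : M (a :: l) = M [a] * M l := M_append [a] l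
    have hsymm : (M [a]).transpose = M [a] := by
      rw [M_singleton]
      ext i j
      fin_cases i <;> fin_cases j <;> rfl
    rw [List.reverse_cons, M_append, ih, hcons, Matrix.transpose_mul, hsymm]

lemma det_M (l : List ℤ) : (M l).det = (-1) ^ l.length := by
  induction l with
  | nil => simp [M]
  | cons a l ih =>
    have hcons : M (a :: l) = M [a] * M l := M_append [a] l
    rw [hcons, Matrix.det_mul, ih, M_singleton, Matrix.det_fin_two_of, List.length_cons]
    ring

lemma padicValNat_le_of_add_eq_two_pow {a b m : ℕ} (ha : a ≠ 0) (hb : b ≠ 0)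
    (hab : a + b = 2 ^ m) : padicValNat 2 a ≤ padicValNat 2 b := by
  have hdvd : 2 ^ padicValNat 2 a ∣ a := pow_padicValNat_dvd
  have hlt : 2 ^ padicValNat 2 a < 2 ^ m := by
    have := Nat.le_of_dvd (Nat.pos_of_ne_zero ha) hdvd
    omega
  have hm : 2 ^ padicValNat 2 a ∣ 2 ^ m :=
    pow_dvd_pow 2 ((Nat.pow_lt_pow_iff_right one_lt_two).1 hlt).le
  rw [← hab, Nat.dvd_add_right hdvd] at hm
  exact (padicValNat_dvd_iff_le hb).1 hm

lemma s_eq_of_add_eq_two_pow {i j m : ℕ} (h : i + 1 + (j + 1) = 2 ^ m) : s i = s j := by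
  unfold s
  rw [le_antisymm (padicValNat_le_of_add_eq_two_pow i.succ_ne_zero j.succ_ne_zero h)
    (padicValNat_le_of_add_eq_two_pow j.succ_ne_zero i.succ_ne_zero ((add_comm _ _).trans h))]

lemma s_two_pow_sub_one (n : ℕ) : s (2 ^ n - 1) = 2 ^ n := by
  unfold s
  rw [Nat.sub_add_cancel Nat.one_le_two_pow, padicValNat.prime_pow]

lemma u_succ {n : ℕ} (hn : n ≠ 0) : u (n + 1) = v n ++ [(2 : ℤ) ^ n] ++ (v n).reverse := by
  have hpow : 2 ^ (n + 1) = 2 * 2 ^ n := pow_succ' 2 n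
  have hle : 2 ≤ 2 ^ n := Nat.le_self_pow hn 2
  apply List.ext_getElem
  · simp [u, v]
    omega
  · intro k h₁ h₂
    have hk : k < 2 ^ (n + 1) - 3 := by simpa [u] using h₁
    rcases lt_trichotomy k (2 ^ n - 2) with h | h | h
    · rw [List.getElem_append_left (by simp [v]; omega),
        List.getElem_append_left (by simpa [v] using h)]
      simp [u, v]
    · subst h
      rw [List.getElem_append_left (by simp [v]), List.getElem_append_right (by simp [v])]
      have hs := s_two_pow_sub_one n
      rw [show 2 ^ n - 1 = 2 ^ n - 2 + 1 by omega] at hs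
      simp [u, v, hs]
    · rw [List.getElem_append_right (by simp [v]; omega), List.getElem_reverse]
      simp only [u, v, List.getElem_map, List.getElem_range, List.length_append, List.length_map,
        List.length_range, List.length_singleton]
      exact congrArg _ (s_eq_of_add_eq_two_pow (m := n + 1) (by omega))

end Paper

open Paper Filter Real

/-- For n ≥ 2, `g_{n+1} = (2^n w_n + 2 y_n)(2 x_n + w_n) + 2^n x_n² + 2 x_n z_n + 2`. -/
theorem g_succ_eq (n : ℕ) (hn : 2 ≤ n) :
    g (n + 1) = (2 ^ n * w n + 2 * y n) * (2 * x n + w n)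
      + 2 ^ n * x n ^ 2 + 2 * x n * z n + 2 := by
  have hdet : w n * z n - y n * x n = 1 := by
    have h := det_M (v n)
    rw [Matrix.det_fin_two] at h
    have heven : Even (v n).length := by
      simpa [v] using (even_two.pow_of_ne_zero (by omega : n ≠ 0)).tsub even_two
    rwa [heven.neg_one_pow] at h
  have hM : M (u (n + 1)) = M (v n) * !![2 ^ n, 1; 1, 0] * (M (v n)).transpose := by
    rw [u_succ (by omega), M_append, M_append, M_singleton, M_reverse]
  simp only [g, c, e, f, hM, Matrix.mul_apply, Fin.sum_univ_two, Matrix.transpose_apply,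
    Matrix.of_apply, Matrix.cons_val', Matrix.cons_val_zero, Matrix.cons_val_one,
    Matrix.cons_val_fin_one]
  simp only [w, x, y, z] at hdet ⊢
  linear_combination 2 * hdet
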